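/- Let (V, ω) be a finite-dimensional real symplectic vector space and let C₁, C₂ be linearly independent ω-skew endomorphisms of V such that the pair (C₁, C₂) satisfies the curvature equations (Ea) and (Eb). Assume that every real linear combination a·C₁ + b·C₂ is nilpotent and that C₁∘C₁ ≠ 0. Then there exists a nonzero C in the linear span of {C₁, C₂} such that C∘C = 0, C∘C₁ = 0 and C₁∘C = 0. -/

import Mathlib

/-- The endomorphism `u∘v : w ↦ ω(v,w)·u + ω(u,w)·v`. -/
noncomputable def rond {V : Type*} [AddCommGroup V] [Module ℝ V]
    (ω : LinearMap.BilinForm ℝ V) (u v : V) : V →ₗ[ℝ] V :=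
  (ω v).smulRight u + (ω u).smulRight v

section CurvatureEquations

variable {V : Type*} [AddCommGroup V] [Module ℝ V] {ω : LinearMap.BilinForm ℝ V}

theorem rond_apply (u v w : V) : rond ω u v w = ω v w • u + ω u w • v := by
  simp [rond]

/-- The product `u∘v` for a nondegenerate form has no zero divisors. -/
theorem eq_zero_or_eq_zero_of_rond_eq_zero (hNd : ω.Nondegenerate) {u v : V}
    (h : rond ω u v = 0) : u = 0 ∨ v = 0 := by
  by_contra! hne
  obtain ⟨hu, hv⟩ := hne
  obtain ⟨w, hw⟩ : ∃ w, ω v w ≠ 0 := by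
    by_contra! hall
    exact hv (hNd.1 v hall)
  have huv (z : V) : ω v z • u + ω u z • v = 0 := by
    rw [← rond_apply, h, LinearMap.zero_apply]
  obtain ⟨t, rfl⟩ : ∃ t : ℝ, u = t • v := by
    refine ⟨-(ω u w / ω v w), ?_⟩
    have := congrArg ((ω v w)⁻¹ • ·) (huv w)
    simp only [smul_add, smul_smul, inv_mul_cancel₀ hw, one_smul, smul_zero] at this
    rw [neg_smul, div_eq_inv_mul]
    exact eq_neg_of_add_eq_zero_left this
  have hz := huv w
  simp only [map_smul, LinearMap.smul_apply, smul_smul, ← add_smul, smul_eq_mul] at hz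
  have ht : t = 0 := by
    have := (smul_eq_zero.mp hz).resolve_right hv
    have : t * ω v w = 0 := by linarith
    exact (mul_eq_zero.mp this).resolve_right hw
  exact hu (by rw [ht, zero_smul])

/-- If `A` is nilpotent and `B ≠ 0`, some vector outside `ker B` is sent into `ker B` by `A`. -/
theorem exists_ne_zero_and_comp_eq_zero {A B : Module.End ℝ V} (hA : IsNilpotent A)
    (hB : B ≠ 0) : ∃ y, B y ≠ 0 ∧ B (A y) = 0 := by
  obtain ⟨n, hn⟩ := hA
  by_contra! h
  obtain ⟨y, hy⟩ : ∃ y, B y ≠ 0 := by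
    by_contra! hall
    exact hB (LinearMap.ext hall)
  have hpow (k : ℕ) : B ((A ^ k) y) ≠ 0 := by
    induction k with
    | zero => simpa using hy
    | succ k ih =>
      rw [pow_succ', Module.End.mul_apply]
      exact h _ ih
  exact hpow n (by simp [hn])

/-- A nonzero `A` has a generalized inverse `g`, and `A ∘ g`, a projection, has positive trace. -/
theorem exists_generalized_inverse [FiniteDimensional ℝ V] {A : V →ₗ[ℝ] V} (hA : A ≠ 0) :
    ∃ g : V →ₗ[ℝ] V, (∀ x, A (g (A x)) = A x) ∧ 0 < LinearMap.trace ℝ V (A ∘ₗ g) := by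
  obtain ⟨h, hh⟩ := A.rangeRestrict.exists_rightInverse_of_surjective A.range_rangeRestrict
  obtain ⟨p, hp⟩ := A.range.subtype.exists_leftInverse_of_injective A.range.ker_subtype
  have hAh (u : A.range) : A (h u) = u := congrArg Subtype.val (LinearMap.congr_fun hh u)
  have hpr (u : A.range) : p u = u := LinearMap.congr_fun hp u
  have hproj : LinearMap.IsProj A.range (A ∘ₗ h ∘ₗ p) :=
    ⟨fun x => ⟨_, rfl⟩, fun x hx => by
      have := hpr ⟨x, hx⟩
      simp only at this
      simp [this, hAh]⟩
  refine ⟨h ∘ₗ p, fun x => hproj.map_id (A x) ⟨x, rfl⟩, ?_⟩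
  rw [hproj.trace, Nat.cast_pos, Module.finrank_pos_iff, Submodule.nontrivial_iff_ne_bot]
  exact fun h0 => hA (LinearMap.range_eq_bot.mp h0)

theorem trace_rond_comp [FiniteDimensional ℝ V] (g : V →ₗ[ℝ] V) (u v : V) :
    LinearMap.trace ℝ V (rond ω u v ∘ₗ g) = ω v (g u) + ω u (g v) := by
  have : rond ω u v ∘ₗ g = (ω v ∘ₗ g).smulRight u + (ω u ∘ₗ g).smulRight v := by
    ext w
    simp [rond]
  simp [this]

/-- The left-hand side of the curvature equation with first factor `C`; the equations
(Ea) and (Eb) are the cases `C = A` and `C = B`. -/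
noncomputable def curvature (ω : LinearMap.BilinForm ℝ V) (A B C : V →ₗ[ℝ] V) (x y : V) :
    V →ₗ[ℝ] V :=
  rond ω (C (A x)) (B y) - rond ω (C (B x)) (A y) - rond ω (C (A y)) (B x)
    + rond ω (C (B y)) (A x) + ω (C (B y) + B (C y)) x • A - ω (C (A y) + A (C y)) x • B

theorem curvature_sub_smul (A B C D : V →ₗ[ℝ] V) (s : ℝ) (x y : V) :
    curvature ω A (B - s • A) (C - s • D) x y
      = curvature ω A B C x y - s • curvature ω A B D x y := by
  ext z
  simp only [curvature, LinearMap.add_apply, LinearMap.sub_apply, LinearMap.smul_apply,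
    rond_apply, map_add, map_sub, map_smul, smul_eq_mul]
  module

theorem trace_curvature_comp [FiniteDimensional ℝ V] (A B C g : V →ₗ[ℝ] V) (x y : V) :
    LinearMap.trace ℝ V (curvature ω A B C x y ∘ₗ g) =
      (ω (B y) (g (C (A x))) + ω (C (A x)) (g (B y)))
      - (ω (A y) (g (C (B x))) + ω (C (B x)) (g (A y)))
      - (ω (B x) (g (C (A y))) + ω (C (A y)) (g (B x)))
      + (ω (A x) (g (C (B y))) + ω (C (B y)) (g (A x)))
      + ω (C (B y) + B (C y)) x * LinearMap.trace ℝ V (A ∘ₗ g)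
      - ω (C (A y) + A (C y)) x * LinearMap.trace ℝ V (B ∘ₗ g) := by
  simp only [curvature, LinearMap.add_comp, LinearMap.sub_comp, LinearMap.smul_comp, map_add,
    map_sub, map_smul, trace_rond_comp, smul_eq_mul]

/-- If `A` is nilpotent with `A ∘ A ≠ 0`, then (Ea) forces `ker A ⊆ ker B`. -/
theorem apply_eq_zero_of_apply_eq_zero (hAlt : ω.IsAlt) (hNd : ω.Nondegenerate)
    {A B : V →ₗ[ℝ] V} (hA : ∀ x y, ω (A x) y = -ω x (A y)) (hB : ∀ x y, ω (B x) y = -ω x (B y))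
    (hE : ∀ x y, curvature ω A B A x y = 0) (hnil : IsNilpotent (A : Module.End ℝ V))
    (hsq : A ∘ₗ A ≠ 0) {x : V} (hx : A x = 0) : B x = 0 := by
  have key (y z : V) : ω (A y) z • A (B x) + ω (A (B x)) z • A y + ω (B x) z • A (A y)
      + ω (A (A y)) z • B x = ω y (A (B x)) • A z := by
    have := LinearMap.congr_fun (hE x y) z
    simp only [curvature, LinearMap.add_apply, LinearMap.sub_apply, LinearMap.smul_apply,
      rond_apply, hx, map_add, map_zero, LinearMap.zero_apply] at this
    have e₁ : ω (A (B y)) x = 0 := by rw [hA, hx, map_zero, neg_zero]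
    have e₂ : ω (B (A y)) x = ω y (A (B x)) := by rw [hB, hA, neg_neg]
    have e₃ : ω (A (A y)) x = 0 := by rw [hA, hx, map_zero, neg_zero]
    rw [e₁, e₂, e₃] at this
    linear_combination (norm := module) (-1 : ℝ) • this
  obtain ⟨w, hw⟩ : ∃ w, A (A w) ≠ 0 := by
    by_contra! hall
    exact hsq (LinearMap.ext hall)
  have hA0 : A ≠ 0 := by
    rintro rfl
    exact hw rfl
  obtain ⟨y, hy, hyy⟩ := exists_ne_zero_and_comp_eq_zero hnil hA0
  have key₁ (z : V) : rond ω (A (B x)) (A y) z = ω y (A (B x)) • A z := by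
    rw [rond_apply, ← key y z, hyy]
    simp
  have hpq : ω (A (B x)) (A y) = 0 := by rw [hA, hyy, map_zero, neg_zero]
  have hqp : ω (A y) (A (B x)) = 0 := by rw [← hAlt.neg_eq, hpq, neg_zero]
  have hc : ω y (A (B x)) = 0 := by
    have h₁ : rond ω (A (B x)) (A y) (rond ω (A (B x)) (A y) w) = 0 := by
      simp [rond_apply, hpq, hqp, hAlt.self_eq_zero]
    rw [key₁ w, map_smul, key₁] at h₁
    simpa [hw] using h₁
  have hABx : A (B x) = 0 := by
    refine (eq_zero_or_eq_zero_of_rond_eq_zero hNd ?_).resolve_right hy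
    ext z
    rw [key₁, hc, zero_smul, LinearMap.zero_apply]
  refine (eq_zero_or_eq_zero_of_rond_eq_zero hNd ?_).resolve_right hw
  ext z
  have := key w z
  simp only [hABx, map_zero, LinearMap.zero_apply, zero_smul, smul_zero, zero_add] at this
  rw [rond_apply, LinearMap.zero_apply, ← this, add_comm]

/-- If `ker A ⊆ ker B` and `tr (B ∘ g) = 0` for a generalized inverse `g` of `A`, then the
curvature equations force `B` to annihilate both `A` and itself. -/
theorem comp_eq_zero_of_trace_eq_zero [FiniteDimensional ℝ V] (hAlt : ω.IsAlt)
    (hNd : ω.Nondegenerate) {A B g : V →ₗ[ℝ] V}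
    (hA : ∀ x y, ω (A x) y = -ω x (A y)) (hB : ∀ x y, ω (B x) y = -ω x (B y))
    (hEa : ∀ x y, curvature ω A B A x y = 0) (hEb : ∀ x y, curvature ω A B B x y = 0)
    (hnil : IsNilpotent (A : Module.End ℝ V)) (hB0 : B ≠ 0)
    (hker : ∀ x, A x = 0 → B x = 0) (hg : ∀ x, A (g (A x)) = A x)
    (hpos : 0 < LinearMap.trace ℝ V (A ∘ₗ g)) (htr : LinearMap.trace ℝ V (B ∘ₗ g) = 0) :
    B ∘ₗ B = 0 ∧ B ∘ₗ A = 0 ∧ A ∘ₗ B = 0 := by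
  have hBgA (x : V) : B (g (A x)) = B x := by
    rw [← sub_eq_zero, ← map_sub]
    exact hker _ (by rw [map_sub, hg, sub_self])
  have hAgB (y : V) : A (g (B y)) = B y := by
    obtain ⟨v, hv⟩ := (ω.toDual hNd).surjective (ω (B y) ∘ₗ g)
    have hv' (z : V) : ω v z = ω (B y) (g z) := by
      rw [← LinearMap.BilinForm.toDual_def hNd, hv, LinearMap.comp_apply]
    have : B y = A (-v) := by
      rw [← sub_eq_zero]
      refine hNd.1 _ fun z => ?_
      rw [map_sub, LinearMap.sub_apply, hA, map_neg, LinearMap.neg_apply, hv', hB, hB, hBgA]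
      ring
    rw [this, hg]
  have swap (x y : V) : ω x y = -ω y x := (hAlt.neg_eq y x).symm
  have ext_zero {T : V →ₗ[ℝ] V} (h : ∀ x y, ω (T y) x = 0) : T = 0 :=
    LinearMap.ext fun y => hNd.1 _ fun x => h x y
  have hanti (y : V) : A (B y) = -B (A y) := by
    suffices A ∘ₗ B + B ∘ₗ A = 0 from eq_neg_of_add_eq_zero_left (LinearMap.congr_fun this y)
    refine ext_zero fun x y => ?_
    have h := trace_curvature_comp (ω := ω) A B A g x y
    rw [hEa, LinearMap.zero_comp, map_zero, htr] at h
    simp only [hA, hB, hg, hBgA, hAgB] at h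
    have : ω (A (B y) + B (A y)) x * LinearMap.trace ℝ V (A ∘ₗ g) = 0 := by
      linarith [swap (A x) (B y), swap (A y) (B x), hA x (B y), hA y (B x), hB x (A y), hB y (A x)]
    exact (mul_eq_zero.mp this).resolve_right hpos.ne'
  have hBA (y : V) : B (A y) = -A (B y) := by rw [hanti, neg_neg]
  have hBB (x : V) : B (B x) = 0 := by
    suffices B ∘ₗ B = 0 from LinearMap.congr_fun this x
    refine ext_zero fun x y => ?_
    have h := trace_curvature_comp (ω := ω) A B B g x y
    rw [hEb, LinearMap.zero_comp, map_zero, htr] at h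
    simp only [hBA, hA, hB, hBgA, hAgB, map_neg, map_add, LinearMap.neg_apply,
      LinearMap.add_apply] at h
    have hsymm : ω x (B (B y)) = -ω y (B (B x)) := by rw [swap, hB, hB, neg_neg]
    have : ω (B (B y)) x * (4 + LinearMap.trace ℝ V (A ∘ₗ g)) = 0 := by
      rw [hB, hB]
      rw [hsymm] at h
      linear_combination -h / 2
    exact (mul_eq_zero.mp this).resolve_right (by positivity)
  have hBA0 (x : V) : B (A x) = 0 := by
    obtain ⟨y, hy, hyy⟩ := exists_ne_zero_and_comp_eq_zero hnil hB0
    refine (eq_zero_or_eq_zero_of_rond_eq_zero hNd ?_).resolve_right hy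
    have h := hEb x y
    simpa [curvature, hBB, hyy, hanti, rond] using h
  refine ⟨LinearMap.ext hBB, LinearMap.ext hBA0, LinearMap.ext fun x => ?_⟩
  rw [LinearMap.comp_apply, hanti, hBA0, neg_zero, LinearMap.zero_apply]

end CurvatureEquations

/-- If linearly independent `ω`-skew `C₁, C₂` satisfy the curvature
equations, every combination is nilpotent and `C₁∘C₁ ≠ 0`, then there is a nonzero `C` in
the span of `{C₁, C₂}` with `C∘C = C∘C₁ = C₁∘C = 0`. -/
theorem exists_annihilating_element
    (V : Type*) [AddCommGroup V] [Module ℝ V] [FiniteDimensional ℝ V]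
    (ω : LinearMap.BilinForm ℝ V) (hAlt : ω.IsAlt) (hNd : ω.Nondegenerate)
    (C₁ C₂ : V →ₗ[ℝ] V)
    (h₁ : ∀ x y, ω (C₁ x) y + ω x (C₁ y) = 0)
    (h₂ : ∀ x y, ω (C₂ x) y + ω x (C₂ y) = 0)
    (hli : LinearIndependent ℝ ![C₁, C₂])
    (hEa : ∀ x y : V,
      rond ω (C₁ (C₁ x)) (C₂ y) - rond ω (C₁ (C₂ x)) (C₁ y)
        - rond ω (C₁ (C₁ y)) (C₂ x) + rond ω (C₁ (C₂ y)) (C₁ x)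
        + ω ((C₁ ∘ₗ C₂ + C₂ ∘ₗ C₁) y) x • C₁ - (2 * ω (C₁ (C₁ y)) x) • C₂ = 0)
    (hEb : ∀ x y : V,
      rond ω (C₂ (C₁ x)) (C₂ y) - rond ω (C₂ (C₂ x)) (C₁ y)
        - rond ω (C₂ (C₁ y)) (C₂ x) + rond ω (C₂ (C₂ y)) (C₁ x)
        + (2 * ω (C₂ (C₂ y)) x) • C₁ - ω ((C₂ ∘ₗ C₁ + C₁ ∘ₗ C₂) y) x • C₂ = 0)
    (hnil : ∀ a b : ℝ, IsNilpotent (a • C₁ + b • C₂ : Module.End ℝ V))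
    (hC₁sq : C₁ ∘ₗ C₁ ≠ 0) :
    ∃ C ∈ Submodule.span ℝ ({C₁, C₂} : Set (V →ₗ[ℝ] V)),
      C ≠ 0 ∧ C ∘ₗ C = 0 ∧ C ∘ₗ C₁ = 0 ∧ C₁ ∘ₗ C = 0 := by
  have hA (x y : V) : ω (C₁ x) y = -ω x (C₁ y) := eq_neg_of_add_eq_zero_left (h₁ x y)
  have hB (x y : V) : ω (C₂ x) y = -ω x (C₂ y) := eq_neg_of_add_eq_zero_left (h₂ x y)
  have hEa' (x y : V) : curvature ω C₁ C₂ C₁ x y = 0 := by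
    rw [← hEa x y, curvature, ← two_smul ℝ (C₁ (C₁ y))]
    simp
  have hEb' (x y : V) : curvature ω C₁ C₂ C₂ x y = 0 := by
    rw [← hEb x y, curvature, ← two_smul ℝ (C₂ (C₂ y))]
    simp
  have hnil₁ : IsNilpotent (C₁ : Module.End ℝ V) := by simpa using hnil 1 0
  have hC₁ : C₁ ≠ 0 := by
    rintro rfl
    exact hC₁sq (LinearMap.zero_comp _)
  obtain ⟨g, hg, hpos⟩ := exists_generalized_inverse hC₁
  set s := LinearMap.trace ℝ V (C₂ ∘ₗ g) / LinearMap.trace ℝ V (C₁ ∘ₗ g) with hs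
  have hne : C₂ - s • C₁ ≠ 0 := fun h0 => by
    have := LinearIndependent.pair_iff.mp hli (-s) 1
      (by rw [← h0]; module)
    exact one_ne_zero this.2
  refine ⟨C₂ - s • C₁, ?_, hne, comp_eq_zero_of_trace_eq_zero hAlt hNd hA ?_ ?_ ?_ hnil₁ hne ?_
    hg hpos ?_⟩
  · exact Submodule.sub_mem _ (Submodule.subset_span (by simp))
      (Submodule.smul_mem _ _ (Submodule.subset_span (by simp)))
  · intro x y
    simp only [LinearMap.sub_apply, LinearMap.smul_apply, map_sub, map_smul, hA, hB, smul_eq_mul]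
    ring
  · intro x y
    have h0 : curvature ω C₁ C₂ 0 x y = 0 := by simp [curvature, rond]
    simpa [hEa', h0] using curvature_sub_smul (ω := ω) C₁ C₂ C₁ 0 s x y
  · intro x y
    simpa [hEa', hEb'] using curvature_sub_smul (ω := ω) C₁ C₂ C₂ C₁ s x y
  · intro x hx
    simp [hx, apply_eq_zero_of_apply_eq_zero hAlt hNd hA hB hEa' hnil₁ hC₁sq hx]
  · rw [LinearMap.sub_comp, LinearMap.smul_comp, map_sub, map_smul, smul_eq_mul, hs,
      div_mul_cancel₀ _ hpos.ne', sub_self]
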